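/- Let (Δ_t) be bounded and strictly positive with −log Δ_t / log log t → c ∈ [0,∞] as t → ∞. Then (1/log log t) · Σ_{p ≤ t} p^{i Δ_t} / p converges, as t → ∞, to min(c,1), where the sum runs over primes p ≤ t. -/

import Mathlib

open Filter
open scoped ENNReal Topology

section

open ArithmeticFunction LSeries
open scoped LSeries.notation

/-- The indicator function of the primes, as a coefficient sequence of an L-series. -/
noncomputable def primeIndicator (n : ℕ) : ℂ := if n.Prime then 1 else 0

lemma abscissaOfAbsConv_primeIndicator_lt {s : ℂ} (hs : 1 < s.re) :
    abscissaOfAbsConv primeIndicator < s.re := by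
  refine lt_of_le_of_lt (abscissaOfAbsConv_le_one_of_isBigO_one ?_) (by exact_mod_cast hs)
  refine Asymptotics.isBigO_of_le _ fun n => ?_
  unfold primeIndicator
  split_ifs <;> simp

lemma residueClass_one_zmod_one (n : ℕ) :
    vonMangoldt.residueClass (1 : ZMod 1) n = vonMangoldt n :=
  Set.indicator_of_mem (s := {n : ℕ | (n : ZMod 1) = 1}) (Subsingleton.elim _ _) _

lemma norm_LSeries_vonMangoldt_sub_logMul_primeIndicator_le :
    ∃ K : ℝ, ∀ s : ℂ, 1 < s.re →
      ‖L ↗vonMangoldt s - L (logMul primeIndicator) s‖ ≤ K := by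
  have hsum := vonMangoldt.summable_residueClass_non_primes_div (q := 1) 1
  refine ⟨∑' n : ℕ, (if n.Prime then 0 else vonMangoldt.residueClass (1 : ZMod 1) n) / n,
    fun s hs => ?_⟩
  · have h1 : LSeriesSummable ↗vonMangoldt s := LSeriesSummable_vonMangoldt hs
    have h2 : LSeriesSummable (logMul primeIndicator) s :=
      LSeriesSummable_logMul_of_lt_re (abscissaOfAbsConv_primeIndicator_lt hs)
    rw [LSeries, LSeries, ← Summable.tsum_sub h1 h2]
    refine tsum_of_norm_bounded hsum.hasSum fun n => ?_
    rw [residueClass_one_zmod_one]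
    rcases eq_or_ne n 0 with rfl | hn
    · simp
    rw [term_of_ne_zero hn, term_of_ne_zero hn, ← sub_div, norm_div,
      Complex.norm_natCast_cpow_of_pos (Nat.pos_of_ne_zero hn)]
    have hnum : ‖((vonMangoldt n : ℝ) : ℂ) - logMul primeIndicator n‖
        = if n.Prime then 0 else vonMangoldt n := by
      unfold logMul primeIndicator
      split_ifs with hp
      · rw [vonMangoldt_apply_prime hp]; simp
      · simp [vonMangoldt_nonneg]
    rw [hnum]
    have hn1 : (1 : ℝ) ≤ n := by exact_mod_cast Nat.one_le_iff_ne_zero.mpr hn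
    have h0 : (0 : ℝ) ≤ if n.Prime then 0 else vonMangoldt n := by
      split_ifs <;> simp [vonMangoldt_nonneg]
    gcongr
    exact Real.self_le_rpow_of_one_le hn1 hs.le

lemma norm_LSeries_logMul_primeIndicator_sub_le (M : ℝ) :
    ∃ K : ℝ, ∀ s : ℂ, 1 < s.re → s.re ≤ 2 → |s.im| ≤ M →
      ‖L (logMul primeIndicator) s - 1 / (s - 1)‖ ≤ K := by
  obtain ⟨K₁, hK₁⟩ := norm_LSeries_vonMangoldt_sub_logMul_primeIndicator_le
  have hcont := vonMangoldt.continuousOn_LFunctionResidueClassAux (q := 1) 1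
  have hcomp : IsCompact (Set.Icc (1 : ℝ) 2 ×ℂ Set.Icc (-M) M) :=
    isCompact_Icc.reProdIm isCompact_Icc
  obtain ⟨K₂, hK₂⟩ := hcomp.exists_bound_of_continuousOn
    (hcont.mono fun s hs => (Complex.mem_reProdIm.mp hs).1.1)
  refine ⟨K₂ + K₁, fun s hs hs2 him => ?_⟩
  have h2 := hK₂ s (Complex.mem_reProdIm.mpr ⟨⟨hs.le, hs2⟩, abs_le.mp him⟩)
  have heq := vonMangoldt.eqOn_LFunctionResidueClassAux (q := 1) (a := 1) isUnit_one hs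
  rw [heq] at h2
  simp only [residueClass_one_zmod_one, Nat.totient_one, Nat.cast_one, inv_one] at h2
  calc _ = ‖(L ↗vonMangoldt s - 1 / (s - 1)) -
        (L ↗vonMangoldt s - L (logMul primeIndicator) s)‖ := by congr 1; ring
    _ ≤ _ := (norm_sub_le _ _).trans (add_le_add h2 (hK₁ s hs))

lemma norm_LSeries_primeIndicator_add_log_le (M : ℝ) :
    ∃ C : ℝ, ∀ σ ≤ (2 : ℝ), 1 < σ → ∀ y : ℝ, |y| ≤ M →
      ‖L primeIndicator (σ + y * Complex.I) + Complex.log (σ + y * Complex.I - 1)‖ ≤ C := by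
  obtain ⟨K, hK⟩ := norm_LSeries_logMul_primeIndicator_sub_le M
  have hcont : ContinuousOn (fun y : ℝ => L primeIndicator ((2 : ℝ) + y * Complex.I) +
      Complex.log ((2 : ℝ) + y * Complex.I - 1)) (Set.Icc (-M) M) := by
    intro y _
    refine ContinuousAt.continuousWithinAt (ContinuousAt.add ?_ ?_)
    · refine ContinuousAt.comp (g := L primeIndicator)
        (LSeries_hasDerivAt (abscissaOfAbsConv_primeIndicator_lt (by simp))).continuousAt
        (by fun_prop)
    · refine ContinuousAt.clog (by fun_prop) (.inl (by norm_num))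
  obtain ⟨B, hB⟩ := isCompact_Icc.exists_bound_of_continuousOn hcont
  refine ⟨B + K, fun σ hσ2 hσ y hδ => ?_⟩
  have hK0 : 0 ≤ K := (norm_nonneg _).trans
    (hK (σ + y * Complex.I) (by simpa) (by simpa) (by simpa))
  set F : ℝ → ℂ := fun x => L primeIndicator (x + y * Complex.I) +
    Complex.log (x + y * Complex.I - 1) with hF
  have hderiv : ∀ x ∈ Set.Icc σ 2, HasDerivWithinAt F
      (-L (logMul primeIndicator) (x + y * Complex.I) + 1 / (x + y * Complex.I - 1))
      (Set.Icc σ 2) x := by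
    intro x hx
    have hx1 : 1 < x := hσ.trans_le hx.1
    have hlin : HasDerivAt (fun x : ℝ => (x : ℂ) + y * Complex.I) 1 x :=
      (Complex.ofRealCLM.hasDerivAt (x := x)).add_const _
    refine (HasDerivAt.add ?_ ?_).hasDerivWithinAt
    · have h := (LSeries_hasDerivAt (abscissaOfAbsConv_primeIndicator_lt
        (s := x + y * Complex.I) (by simpa using hx1)))
      simpa using! h.comp x hlin
    · exact (hlin.sub_const 1).clog_real (.inl (by simpa using hx1))
  have hmv := Convex.norm_image_sub_le_of_norm_hasDerivWithin_le hderiv (C := K)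
    (fun x hx => by
      rw [neg_add_eq_sub, norm_sub_rev]
      exact hK _ (by simpa using hσ.trans_le hx.1) (by simpa using hx.2) (by simpa using hδ))
    (convex_Icc _ _) (Set.right_mem_Icc.mpr hσ2) (Set.left_mem_Icc.mpr hσ2)
  have h2 : ‖F 2‖ ≤ B := hB y (abs_le.mp hδ)
  have h3 : K * ‖σ - 2‖ ≤ K := by
    refine mul_le_of_le_one_right hK0 ?_
    rw [Real.norm_eq_abs, abs_le]; constructor <;> linarith
  calc ‖F σ‖ = ‖F 2 + (F σ - F 2)‖ := by congr 1; ring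
    _ ≤ B + K := (norm_add_le _ _).trans (add_le_add h2 (hmv.trans h3))

lemma norm_sum_primes_sub_LSeries_le :
    ∃ C : ℝ, ∀ t y : ℝ, 1 ≤ Real.log t → 0 < t →
      ‖∑ p ∈ Finset.filter Nat.Prime (Finset.range (⌊t⌋₊ + 1)),
          (p : ℂ) ^ (Complex.I * y) / (p : ℂ) -
        L primeIndicator ((1 + (Real.log t)⁻¹ : ℝ) + (-y : ℝ) * Complex.I)‖ ≤ C := by
  obtain ⟨K, hK⟩ := norm_LSeries_logMul_primeIndicator_sub_le 0
  refine ⟨2 * (1 + K), fun t y ht ht0 => ?_⟩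
  set η := (Real.log t)⁻¹ with hη
  have hη0 : 0 < η := inv_pos.mpr (by linarith)
  have hη1 : η ≤ 1 := inv_le_one_of_one_le₀ ht
  set s : ℂ := (1 + η : ℝ) + (-y : ℝ) * Complex.I with hs
  set x : ℂ := ((1 + η : ℝ) : ℂ) with hx
  have hbound : ‖L (logMul primeIndicator) x‖ ≤ η⁻¹ + K := by
    have h := hK x (by simpa [hx] using hη0) (by rw [hx, Complex.ofReal_re]; linarith)
      (by simp [hx])
    have hx1 : ‖1 / (x - 1)‖ = η⁻¹ := by
      simp [hx, abs_of_pos hη0]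
    calc _ = ‖1 / (x - 1) + (L (logMul primeIndicator) x - 1 / (x - 1))‖ := by congr 1; ring
      _ ≤ _ := (norm_add_le _ _).trans (by rw [hx1]; gcongr)
  have hsummable : LSeriesSummable (logMul primeIndicator) x :=
    LSeriesSummable_logMul_of_lt_re (abscissaOfAbsConv_primeIndicator_lt (by simpa [hx] using hη0))
  have hterm (n : ℕ) : term (logMul primeIndicator) x n =
      ((‖term (logMul primeIndicator) x n‖ : ℝ) : ℂ) := by
    refine (Complex.norm_of_nonneg' (term_nonneg ?_ _)).symm
    unfold logMul primeIndicator
    rw [← Complex.natCast_log]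
    split_ifs
    · rw [mul_one]
      exact_mod_cast Real.log_natCast_nonneg n
    · simp
  have htsum : ∑' n, ‖term (logMul primeIndicator) x n‖ ≤ η⁻¹ + K := by
    refine le_trans (le_of_eq ?_) hbound
    rw [LSeries, tsum_congr hterm, ← Complex.ofReal_tsum, Complex.norm_real, Real.norm_of_nonneg]
    positivity
  set S := Finset.filter Nat.Prime (Finset.range (⌊t⌋₊ + 1))
  set g : ℕ → ℂ := fun n => if n ∈ S then (n : ℂ) ^ (Complex.I * y) / (n : ℂ) else 0 with hg
  have hgsum : HasSum g (∑ p ∈ S, (p : ℂ) ^ (Complex.I * y) / (p : ℂ)) := by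
    rw [← Finset.sum_congr rfl fun p hp => show g p = _ from if_pos hp]
    exact hasSum_sum_of_ne_finset_zero fun n hn => if_neg hn
  have hLsum : HasSum (term primeIndicator s) (L primeIndicator s) :=
    (LSeriesSummable_of_abscissaOfAbsConv_lt_re
      (abscissaOfAbsConv_primeIndicator_lt (by simpa [hs, hx] using hη0))).LSeriesHasSum
  rw [← (hgsum.sub hLsum).tsum_eq]
  have hmaj := (hsummable.norm.hasSum).mul_left (2 * η)
  refine (tsum_of_norm_bounded hmaj fun n => ?_).trans ?_
  · by_cases hp : n.Prime
    swap
    · have : n ∉ S := fun h => hp (Finset.mem_filter.mp h).2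
      simp only [hg, this, if_false, zero_sub, norm_neg]
      rw [term_def, primeIndicator, if_neg hp]
      simp only [zero_div, ite_self, norm_zero]
      positivity
    have hn0 : n ≠ 0 := hp.ne_zero
    have hnpos : (0 : ℝ) < n := by exact_mod_cast hp.pos
    have hnc : (n : ℂ) ≠ 0 := by exact_mod_cast hn0
    have hlog : 0 ≤ Real.log n := Real.log_natCast_nonneg n
    have hrhs : ‖term (logMul primeIndicator) x n‖ = Real.log n * (n : ℝ) ^ (-(1 + η)) := by
      rw [term_of_ne_zero hn0, norm_div, Complex.norm_natCast_cpow_of_pos hp.pos, logMul,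
        primeIndicator, if_pos hp, mul_one, ← Complex.natCast_log, Complex.norm_real,
        Real.norm_of_nonneg hlog, Real.rpow_neg hnpos.le, hx, Complex.ofReal_re, div_eq_mul_inv]
    have hlhs : term primeIndicator s n =
        (n : ℂ) ^ (Complex.I * y) * (((n : ℝ) ^ (-(1 + η)) : ℝ) : ℂ) := by
      rw [term_of_ne_zero hn0, primeIndicator, if_pos hp, one_div, ← Complex.cpow_neg,
        Complex.ofReal_cpow hnpos.le, Complex.ofReal_natCast, ← Complex.cpow_add _ _ hnc]
      congr 1
      rw [hs, hx]; push_cast; ring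
    have hnorm : ‖(n : ℂ) ^ (Complex.I * y)‖ = 1 := by
      rw [Complex.norm_natCast_cpow_of_pos hp.pos]; simp
    rw [hrhs, hlhs]
    have hpow : (0 : ℝ) < (n : ℝ) ^ (-(1 + η)) := Real.rpow_pos_of_pos hnpos _
    have htη : Real.log t = η⁻¹ := by rw [hη, inv_inv]
    by_cases hnt : (n : ℝ) ≤ t
    · have hmem : n ∈ S := Finset.mem_filter.mpr
        ⟨Finset.mem_range.mpr (Nat.lt_succ_of_le (Nat.le_floor hnt)), hp⟩
      have hle : η * Real.log n ≤ 1 := by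
        calc η * Real.log n ≤ η * Real.log t := by gcongr
          _ = 1 := by rw [htη, mul_inv_cancel₀ hη0.ne']
      have hexp : |Real.exp (η * Real.log n) - 1| ≤ 2 * |η * Real.log n| :=
        Real.abs_exp_sub_one_le (by rwa [abs_of_nonneg (by positivity)])
      have hsplit : ((n : ℝ))⁻¹ = (n : ℝ) ^ (-(1 + η)) * Real.exp (η * Real.log n) := by
        rw [mul_comm η, ← Real.rpow_def_of_pos hnpos, ← Real.rpow_add hnpos,
          ← Real.rpow_neg_one]
        congr 1; ring
      have heq : g n - (n : ℂ) ^ (Complex.I * y) * (((n : ℝ) ^ (-(1 + η)) : ℝ) : ℂ) =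
          (n : ℂ) ^ (Complex.I * y) *
            (((n : ℝ) ^ (-(1 + η)) * (Real.exp (η * Real.log n) - 1) : ℝ) : ℂ) := by
        simp only [hg, hmem, if_true]
        rw [div_eq_mul_inv, ← Complex.ofReal_natCast, ← Complex.ofReal_inv, mul_sub, mul_one,
          ← hsplit, Complex.ofReal_sub, mul_sub]
      rw [heq, norm_mul, hnorm, one_mul, Complex.norm_real, norm_mul, Real.norm_of_nonneg hpow.le,
        Real.norm_eq_abs]
      rw [abs_of_nonneg (by positivity : 0 ≤ η * Real.log n)] at hexp
      calc _ ≤ (n : ℝ) ^ (-(1 + η)) * (2 * (η * Real.log n)) := by gcongr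
        _ = _ := by ring
    · have hmem : n ∉ S := fun h => hnt <| (Nat.le_floor_iff ht0.le).mp
        (Nat.lt_succ_iff.mp (Finset.mem_range.mp (Finset.mem_filter.mp h).1))
      simp only [hg, hmem, if_false, zero_sub, norm_neg]
      rw [norm_mul, hnorm, one_mul, Complex.norm_real, Real.norm_of_nonneg hpow.le]
      have hge : 1 ≤ η * Real.log n := by
        calc 1 = η * Real.log t := by rw [htη, mul_inv_cancel₀ hη0.ne']
          _ ≤ η * Real.log n := by
            have := not_le.mp hnt
            gcongr
      nlinarith
  · calc 2 * η * ∑' n, ‖term (logMul primeIndicator) x n‖ ≤ 2 * η * (η⁻¹ + K) := by gcongr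
      _ = 2 * (1 + η * K) := by field_simp
      _ ≤ 2 * (1 + K) := by
        have hK0 : 0 ≤ K := (norm_nonneg _).trans
          (hK x (by simpa [hx] using hη0) (by rw [hx, Complex.ofReal_re]; linarith) (by simp [hx]))
        have := mul_le_of_le_one_left hK0 hη1
        linarith

/-- The principal logarithm in the closed right half plane differs by a bounded amount from
the logarithm of the maximum norm. -/
lemma norm_log_sub_log_max_le {x y : ℝ} (hx : 0 < x) (hy : 0 < y) :
    ‖Complex.log (x + (-y : ℝ) * Complex.I) - (Real.log (max x y) : ℝ)‖ ≤
      Real.log 2 + Real.pi := by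
  set w : ℂ := x + (-y : ℝ) * Complex.I with hw
  have hmax : 0 < max x y := lt_max_of_lt_left hx
  have hre : w.re = x := by simp [hw]
  have him : w.im = -y := by simp [hw]
  have hlow : max x y ≤ ‖w‖ := by
    refine max_le ?_ ?_
    · simpa [hre, abs_of_pos hx] using Complex.abs_re_le_norm w
    · simpa [him, abs_of_pos hy] using Complex.abs_im_le_norm w
  have hup : ‖w‖ ≤ 2 * max x y := by
    have := Complex.norm_le_abs_re_add_abs_im w
    rw [hre, him, abs_neg, abs_of_pos hx, abs_of_pos hy] at this
    linarith [le_max_left x y, le_max_right x y]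
  have hl1 := Real.log_le_log hmax hlow
  have hl2 := Real.log_le_log (hmax.trans_le hlow) hup
  rw [Real.log_mul two_ne_zero hmax.ne'] at hl2
  have heq : Complex.log w - (Real.log (max x y) : ℝ) =
      ((Real.log ‖w‖ - Real.log (max x y) : ℝ) : ℂ) + (w.arg : ℂ) * Complex.I := by
    rw [Complex.log]; push_cast; ring
  rw [heq]
  refine (norm_add_le _ _).trans (add_le_add ?_ ?_)
  · rw [Complex.norm_real, Real.norm_of_nonneg (by linarith)]; linarith
  · simpa using Complex.abs_arg_le_pi w

/-- Uniformly in bounded `y > 0`, the sum `∑_{p ≤ t} p^{iy}/p` is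
`min (log log t) (-log y) + O(1)`. -/
lemma norm_sum_primes_sub_min_le (M : ℝ) :
    ∃ C : ℝ, ∀ t y : ℝ, 1 ≤ Real.log t → 0 < t → 0 < y → y ≤ M →
      ‖∑ p ∈ Finset.filter Nat.Prime (Finset.range (⌊t⌋₊ + 1)),
          (p : ℂ) ^ (Complex.I * y) / (p : ℂ) -
        (min (-Real.log y) (Real.log (Real.log t)) : ℝ)‖ ≤ C := by
  obtain ⟨C₁, h₁⟩ := norm_sum_primes_sub_LSeries_le
  obtain ⟨C₂, h₂⟩ := norm_LSeries_primeIndicator_add_log_le M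
  refine ⟨C₁ + C₂ + (Real.log 2 + Real.pi), fun t y ht ht0 hδ hδM => ?_⟩
  have hη0 : 0 < (Real.log t)⁻¹ := inv_pos.mpr (by linarith)
  have hη1 : (Real.log t)⁻¹ ≤ 1 := inv_le_one_of_one_le₀ ht
  have e1 := h₁ t y ht ht0
  have e2 := h₂ (1 + (Real.log t)⁻¹) (by linarith) (by linarith) (-y)
    (by rwa [abs_neg, abs_of_pos hδ])
  have e3 := norm_log_sub_log_max_le hη0 hδ
  have hmin : min (-Real.log y) (Real.log (Real.log t)) =
      -Real.log (max (Real.log t)⁻¹ y) := by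
    rw [Real.strictMonoOn_log.monotoneOn.map_max hη0 hδ, Real.log_inv, max_comm, ← min_neg_neg,
      neg_neg]
  rw [show ((1 + (Real.log t)⁻¹ : ℝ) : ℂ) + (-y : ℝ) * Complex.I - 1 =
    ((Real.log t)⁻¹ : ℝ) + (-y : ℝ) * Complex.I by push_cast; ring] at e2
  rw [hmin]
  refine le_trans (le_of_eq ?_) ((norm_sub_le _ _).trans
    (add_le_add ((norm_add_le _ _).trans (add_le_add e1 e2)) e3))
  congr 1
  push_cast
  ring

end

/-- Lemma 6 of the paper: for `Δ_t` bounded and positive with `-log Δ_t / log log t → c`,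
`(1/log log t) ∑_{p ≤ t} p^{iΔ_t}/p → min(c,1)`. -/
theorem prime_sum_asymptotics_eps_small
    (Δ : ℝ → ℝ) (hΔpos : ∀ t, 0 < Δ t) (M : ℝ) (hΔub : ∀ t, Δ t ≤ M)
    (c : ℝ≥0∞)
    (hc : Tendsto (fun t => ((-Real.log (Δ t) / Real.log (Real.log t) : ℝ) : EReal))
      atTop (𝓝 c)) :
    Tendsto (fun t => ((Real.log (Real.log t) : ℂ))⁻¹ *
        ∑ p ∈ Finset.filter Nat.Prime (Finset.range (⌊t⌋₊ + 1)),
          (p : ℂ) ^ (Complex.I * Δ t) / (p : ℂ))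
      atTop (𝓝 (((min c 1).toReal : ℂ))) := by
  obtain ⟨C, hC⟩ := norm_sum_primes_sub_min_le M
  have hloglog : Tendsto (fun t => Real.log (Real.log t)) atTop atTop :=
    Real.tendsto_log_atTop.comp Real.tendsto_log_atTop
  have hmain : Tendsto (fun t => min (-Real.log (Δ t) / Real.log (Real.log t)) 1) atTop
      (𝓝 (min c 1).toReal) := by
    have h1 : Tendsto (fun t => min ((-Real.log (Δ t) / Real.log (Real.log t) : ℝ) : EReal) 1)
        atTop (𝓝 ((min c 1 : ℝ≥0∞) : EReal)) := by
      have h := hc.min (tendsto_const_nhds (x := (1 : EReal)))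
      rwa [← EReal.coe_ennreal_one, ← Monotone.map_min
        (fun _ _ h => EReal.coe_ennreal_le_coe_ennreal_iff.mpr h)] at h
    have h2 := (EReal.tendsto_toReal (a := ((min c 1 : ℝ≥0∞) : EReal))
      (by simp) (EReal.coe_ennreal_ne_bot _)).comp h1
    rw [EReal.toReal_coe_ennreal] at h2
    refine h2.congr fun t => ?_
    rw [Function.comp_apply, ← EReal.coe_one, ← EReal.coe_strictMono.monotone.map_min,
      EReal.toReal_coe]
  have hmainC := (Complex.continuous_ofReal.tendsto _).comp hmain
  refine tendsto_of_tendsto_of_dist hmainC ?_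
  refine squeeze_zero' (.of_forall fun _ => dist_nonneg) ?_ (hloglog.const_div_atTop C)
  filter_upwards [hloglog.eventually_gt_atTop 0, Real.tendsto_log_atTop.eventually_ge_atTop 1,
    eventually_gt_atTop 0] with t hℓ ht ht0
  have h := hC t (Δ t) ht ht0 (hΔpos t) (hΔub t)
  set ℓ := Real.log (Real.log t)
  have hmin : min (-Real.log (Δ t) / ℓ) 1 = ℓ⁻¹ * min (-Real.log (Δ t)) ℓ := by
    rw [← div_self hℓ.ne', min_div_div_right hℓ.le, div_eq_inv_mul]
  rw [Function.comp_apply, hmin, dist_comm, dist_eq_norm, Complex.ofReal_mul, Complex.ofReal_inv,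
    ← mul_sub, norm_mul, norm_inv, Complex.norm_real, Real.norm_of_nonneg hℓ.le, div_eq_inv_mul]
  gcongr
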